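/- Let d ≥ 2 and k ≥ d+1 be integers, let K ⊆ ℝ^d be a convex body with λ_d(K) = 1, and let S be n ≥ k i.i.d. uniform points in K. Then the expected number of k-islands in S is at most 2^{d−1} · (2 d^{2d−1} binom(k, ⌊d/2⌋))^{k−d−1} · (k−d) · n(n−1)⋯(n−k+2) / ((n−k+1)^{k−d−1}); in particular it is O(n^d) for fixed d and k. -/

import Mathlib

open MeasureTheory

/-- The `(d+1) × (d+1)` matrix whose rows are the homogeneous coordinates of `d + 1` points. -/
def homMatrix {d : ℕ} (p : Fin (d + 1) → Fin d → ℝ) : Matrix (Fin (d + 1)) (Fin (d + 1)) ℝ :=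
  Matrix.of fun i => Fin.snoc (p i) 1

/-- The determinant of the homogeneous coordinates of `d + 1` points: `± d!` times the volume of
the simplex that they span. -/
def homDet {d : ℕ} (p : Fin (d + 1) → Fin d → ℝ) : ℝ := (homMatrix p).det

lemma Continuous.homDet {d : ℕ} {X : Type*} [TopologicalSpace X]
    {f : X → Fin (d + 1) → Fin d → ℝ} (hf : Continuous f) : Continuous fun x => homDet (f x) := by
  unfold _root_.homDet homMatrix
  refine Continuous.matrix_det (continuous_pi fun i => continuous_pi fun j => ?_)
  simp only [Matrix.of_apply]
  fun_prop

lemma homMatrix_update {d : ℕ} (p : Fin (d + 1) → Fin d → ℝ) (i : Fin (d + 1)) (y : Fin d → ℝ) :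
    homMatrix (Function.update p i y) = (homMatrix p).updateRow i (Fin.snoc y 1) := by
  ext a b
  by_cases h : a = i
  · subst h; simp [homMatrix]
  · simp [homMatrix, h]

lemma homDet_eq_det_sub {d : ℕ} (p : Fin (d + 1) → Fin d → ℝ) :
    homDet p = (Matrix.of fun i j => p i.castSucc j - p (Fin.last d) j).det := by
  have h := Matrix.det_eq_of_forall_row_eq_smul_add_const (A := homMatrix p)
    (B := Matrix.of fun i j => if i = Fin.last d then homMatrix p i j
      else homMatrix p i j - homMatrix p (Fin.last d) j)
    (fun i => if i = Fin.last d then 0 else 1) (Fin.last d) (by simp)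
    (fun i j => by by_cases hi : i = Fin.last d <;> simp [hi])
  rw [homDet, h, Matrix.det_succ_column _ (Fin.last d), Fin.sum_univ_castSucc]
  have hz : ∀ i : Fin d, (Fin.castSucc i) ≠ Fin.last d := fun i => (Fin.castSucc_lt_last i).ne
  simp only [Matrix.of_apply, hz, if_false]
  rw [Finset.sum_eq_zero (fun i _ => by simp [homMatrix])]
  simp only [homMatrix, Matrix.of_apply, if_true, Fin.snoc_last, mul_one, zero_add]
  rw [Even.neg_one_pow ⟨_, rfl⟩, one_mul]
  congr 1
  ext i j
  simp [hz]

lemma homDet_ne_zero_injective {d : ℕ} {p : Fin (d + 1) → Fin d → ℝ} (h : homDet p ≠ 0) :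
    Function.Injective p := by
  intro i j hij
  by_contra hne
  exact h (Matrix.det_zero_of_row_eq hne (by ext k; simp [homMatrix, hij]))

lemma abs_homDet_comp_equiv {d : ℕ} (p : Fin (d + 1) → Fin d → ℝ)
    (σ : Equiv.Perm (Fin (d + 1))) : |homDet (p ∘ σ)| = |homDet p| := by
  have : homMatrix (p ∘ σ) = (homMatrix p).submatrix σ id := rfl
  rw [homDet, this, Matrix.det_permute, abs_mul, homDet]
  rcases Int.units_eq_one_or (Equiv.Perm.sign σ) with h | h <;> simp [h]

lemma exists_homDet_cons {d : ℕ} (a : Fin (d + 1) → Fin (d + 1) → ℝ) :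
    ∃ c : (Fin d → ℝ) → ℝ, Measurable c ∧ ∀ t y,
      homDet (Fin.cons (Fin.cons t y) a : Fin (d + 2) → Fin (d + 1) → ℝ) =
        t * homDet (fun i => Fin.tail (a i)) + c y := by
  refine ⟨fun y => homDet (Fin.cons (Fin.cons 0 y) a : Fin (d + 2) → Fin (d + 1) → ℝ), ?_, ?_⟩
  · have : Continuous fun y : Fin d → ℝ =>
        homDet (Fin.cons (Fin.cons 0 y) a : Fin (d + 2) → Fin (d + 1) → ℝ) :=
      Continuous.homDet (by fun_prop)
    exact this.measurable
  · intro t y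
    have hsub : ∀ t : ℝ, ∀ i : Fin (d + 2),
        (homMatrix (Fin.cons (Fin.cons t y) a : Fin (d + 2) → Fin (d + 1) → ℝ)).submatrix
          i.succAbove Fin.succ =
        (homMatrix (Fin.cons (Fin.cons 0 y) a : Fin (d + 2) → Fin (d + 1) → ℝ)).submatrix
          i.succAbove Fin.succ := by
      intro t i
      ext u v
      simp only [Matrix.submatrix_apply, homMatrix, Matrix.of_apply]
      rcases Fin.eq_zero_or_eq_succ (i.succAbove u) with h | ⟨w, h⟩
      · rw [h, Fin.cons_zero, Fin.cons_zero, ← Fin.cons_snoc_eq_snoc_cons,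
          ← Fin.cons_snoc_eq_snoc_cons, Fin.cons_succ, Fin.cons_succ]
      · rw [h, Fin.cons_succ, Fin.cons_succ]
    simp only [homDet]
    rw [Matrix.det_succ_column_zero, Fin.sum_univ_succ (n := d + 1),
      Matrix.det_succ_column_zero (homMatrix (Fin.cons (Fin.cons 0 y) a)),
      Fin.sum_univ_succ (n := d + 1)]
    simp only [hsub t]
    have h0 : (homMatrix (Fin.cons (Fin.cons 0 y) a : Fin (d + 2) → Fin (d + 1) → ℝ)).submatrix
        (Fin.succAbove 0) Fin.succ = homMatrix fun i => Fin.tail (a i) := by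
      ext u v
      simp only [Matrix.submatrix_apply, homMatrix, Matrix.of_apply, Fin.succAbove_zero,
        Fin.cons_succ]
      conv_lhs => rw [← Fin.cons_self_tail (a u), ← Fin.cons_snoc_eq_snoc_cons]
      rw [Fin.cons_succ]
    have h1 : ∀ t : ℝ, homMatrix (Fin.cons (Fin.cons t y) a : Fin (d + 2) → Fin (d + 1) → ℝ) 0 0
        = t := fun t => by
      simp [homMatrix]
    have h2 : ∀ (t : ℝ) (i : Fin (d + 1)),
        homMatrix (Fin.cons (Fin.cons t y) a : Fin (d + 2) → Fin (d + 1) → ℝ) i.succ 0 = a i 0 :=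
      fun t i => by simp [homMatrix, Fin.snoc]
    simp only [h0, h1, h2]
    simp

lemma exists_homDet_tail_ne_zero {d : ℕ} (p : Fin (d + 2) → Fin (d + 1) → ℝ) (h : homDet p ≠ 0) :
    ∃ j : Fin (d + 2), homDet (fun i => Fin.tail (p (j.succAbove i))) ≠ 0 := by
  by_contra! h0
  apply h
  rw [homDet, Matrix.det_succ_column_zero]
  refine Finset.sum_eq_zero fun j _ => ?_
  have : (homMatrix p).submatrix j.succAbove Fin.succ =
      homMatrix (fun i => Fin.tail (p (j.succAbove i))) := by
    ext u v
    simp only [Matrix.submatrix_apply, homMatrix, Matrix.of_apply]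
    conv_lhs => rw [← Fin.cons_self_tail (p (j.succAbove u)), ← Fin.cons_snoc_eq_snoc_cons]
    rw [Fin.cons_succ]
  rw [this]
  simp only [homDet] at h0
  rw [h0, mul_zero]

lemma homDet_smul_eq_sum {d : ℕ} (p : Fin (d + 1) → Fin d → ℝ) (y : Fin d → ℝ) :
    (∑ i, homDet (Function.update p i y) = homDet p) ∧
    ∀ j, ∑ i, homDet (Function.update p i y) * p i j = homDet p * y j := by
  have h := Matrix.mulVec_cramer (homMatrix p).transpose (Fin.snoc y 1)
  simp only [Matrix.det_transpose] at h
  have h2 : ∀ i, Matrix.cramer (homMatrix p).transpose (Fin.snoc y 1) i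
      = homDet (Function.update p i y) := fun i => by
    rw [Matrix.cramer_transpose_apply, homDet, homMatrix_update]
  constructor
  · have := congrFun h (Fin.last d)
    simp only [Matrix.mulVec, dotProduct, h2, Matrix.transpose_apply] at this
    simpa [homMatrix, homDet] using this
  · intro j
    have := congrFun h j.castSucc
    simp only [Matrix.mulVec, dotProduct, h2, Matrix.transpose_apply] at this
    simpa [homMatrix, homDet, mul_comm] using this

/-- The affine parametrization of space by the first `d` barycentric coordinates. -/
lemma homDet_update_baryc {d : ℕ} (p : Fin (d + 1) → Fin d → ℝ) (l : Fin d → ℝ)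
    (i : Fin (d + 1)) :
    homDet (Function.update p i
      (p (Fin.last d) + Matrix.vecMul l (Matrix.of fun i j => p i.castSucc j - p (Fin.last d) j)))
      = (Fin.snoc l (1 - ∑ i, l i) : Fin (d + 1) → ℝ) i * homDet p := by
  rw [homDet, homMatrix_update]
  have : (Fin.snoc (p (Fin.last d) + Matrix.vecMul l
      (Matrix.of fun i j => p i.castSucc j - p (Fin.last d) j)) 1 : Fin (d + 1) → ℝ) =
      ∑ k, (Fin.snoc l (1 - ∑ i, l i) : Fin (d + 1) → ℝ) k • homMatrix p k := by
    ext j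
    rw [Fin.sum_univ_castSucc]
    refine Fin.lastCases ?_ (fun j => ?_) j
    · simp [homMatrix]
    · simp [homMatrix, Matrix.vecMul, dotProduct, mul_sub, Finset.sum_sub_distrib, sub_mul,
        Finset.sum_mul]
      ring
  rw [this, Matrix.det_updateRow_sum, homDet, smul_eq_mul]

lemma volume_eq_homDet_mul {d : ℕ} (p : Fin (d + 1) → Fin d → ℝ) (hp : homDet p ≠ 0)
    (s : Set (Fin d → ℝ)) :
    volume s = ENNReal.ofReal |homDet p| * volume {l : Fin d → ℝ | p (Fin.last d) +
      Matrix.vecMul l (Matrix.of fun i j => p i.castSucc j - p (Fin.last d) j) ∈ s} := by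
  set L : Matrix (Fin d) (Fin d) ℝ := Matrix.of fun i j => p i.castSucc j - p (Fin.last d) j
  have hdet : LinearMap.det (Matrix.toLin' L.transpose) = homDet p := by
    rw [LinearMap.det_toLin', Matrix.det_transpose, homDet_eq_det_sub]
  have h := Measure.addHaar_preimage_linearMap (volume : Measure (Fin d → ℝ))
    (hdet.symm ▸ hp) ((p (Fin.last d) + ·) ⁻¹' s)
  have hset : {l : Fin d → ℝ | p (Fin.last d) + Matrix.vecMul l L ∈ s} =
      (Matrix.toLin' L.transpose) ⁻¹' ((p (Fin.last d) + ·) ⁻¹' s) := by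
    ext l
    simp [Matrix.mulVec_transpose]
  rw [hset, h, measure_preimage_add, hdet, ← mul_assoc, ← ENNReal.ofReal_mul (abs_nonneg _),
    abs_inv, mul_inv_cancel₀ (abs_ne_zero.2 hp), ENNReal.ofReal_one, one_mul]

lemma volume_half_cube_le {d : ℕ} (hd : 0 < d) :
    volume {l : Fin d → ℝ | (∀ i, |l i| ≤ 1) ∧ 0 ≤ ∑ i, l i} ≤ 2 ^ (d - 1) := by
  set H : Set (Fin d → ℝ) := {l | (∀ i, |l i| ≤ 1) ∧ 0 ≤ ∑ i, l i}
  have hHm : MeasurableSet H := by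
    refine measurableSet_setOfPred.2 (Measurable.and (Measurable.forall fun i => ?_) ?_) <;>
      exact measurableSet_setOfPred.1 (measurableSet_le (by fun_prop) (by fun_prop))
  have hcube : volume (H ∪ -H) ≤ 2 ^ d := by
    refine (measure_mono (t := Set.Icc (fun _ => -1) (fun _ => 1)) ?_).trans ?_
    · rintro l (h | h)
      · exact ⟨fun i => (abs_le.1 (h.1 i)).1, fun i => (abs_le.1 (h.1 i)).2⟩
      · have h1 : ∀ i, |l i| ≤ 1 := fun i => by simpa using h.1 i
        exact ⟨fun i => (abs_le.1 (h1 i)).1, fun i => (abs_le.1 (h1 i)).2⟩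
    · rw [Real.volume_Icc_pi]
      norm_num
  have hinter : volume (H ∩ -H) = 0 := by
    let f : (Fin d → ℝ) →ₗ[ℝ] ℝ := ∑ i, LinearMap.proj i
    refine measure_mono_null (t := (LinearMap.ker f : Set (Fin d → ℝ))) ?_
      (Measure.addHaar_submodule _ _ ?_)
    · rintro l ⟨h1, h2⟩
      have h3 := h2.2
      have h4 := h1.2
      simp only [Pi.neg_apply, Finset.sum_neg_distrib] at h3
      simp only [SetLike.mem_coe, LinearMap.mem_ker, f, LinearMap.coe_sum, Finset.sum_apply,
        LinearMap.coe_proj, Function.eval]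
      linarith
    · intro htop
      have : f (Pi.single ⟨0, hd⟩ 1) = 0 := by
        rw [← LinearMap.mem_ker, htop]; trivial
      simp [f] at this
  have hsum : volume H + volume H ≤ 2 ^ d := by
    have := measure_union_add_inter (μ := volume) H hHm.neg
    rw [hinter, add_zero, Measure.measure_neg] at this
    rw [← this]
    exact hcube
  obtain ⟨e, rfl⟩ : ∃ e, d = e + 1 := ⟨d - 1, by omega⟩
  rw [← two_mul, pow_succ'] at hsum
  exact (ENNReal.mul_le_mul_iff_right (by norm_num) (by norm_num)).1 hsum

lemma inv_factorial_le_volume_simplex (d : ℕ) :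
    ENNReal.ofReal (1 / d.factorial) ≤
      volume {l : Fin d → ℝ | (∀ i, 0 ≤ l i) ∧ ∑ i, l i ≤ 1} := by
  have h1 := volume_sum_rpow_lt_one (Fin d) (le_refl (1 : ℝ))
  simp only [Real.rpow_one, div_one, Fintype.card_fin] at h1
  rw [Real.Gamma_nat_eq_factorial, one_add_one_eq_two, Real.Gamma_two, mul_one] at h1
  set P : Set (Fin d → ℝ) := {l | (∀ i, 0 ≤ l i) ∧ ∑ i, l i ≤ 1}
  have hcov : {x : Fin d → ℝ | ∑ i, |x i| < 1} ⊆
      ⋃ s : Fin d → Bool, {x : Fin d → ℝ | (fun i => cond (s i) (x i) (-x i)) ∈ P} := by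
    intro x hx
    refine Set.mem_iUnion.2 ⟨fun i => decide (0 ≤ x i), ?_⟩
    have : (fun i => cond (decide (0 ≤ x i)) (x i) (-x i)) = fun i => |x i| := by
      ext i
      by_cases h : 0 ≤ x i
      · simp [h, abs_of_nonneg]
      · simp [h, abs_of_neg (not_le.1 h)]
    rw [Set.mem_ofPred_eq, this]
    exact ⟨fun i => abs_nonneg _, le_of_lt hx⟩
  have heach : ∀ s : Fin d → Bool,
      volume {x : Fin d → ℝ | (fun i => cond (s i) (x i) (-x i)) ∈ P} = volume P := by
    intro s
    have hPm : MeasurableSet P := by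
      refine measurableSet_setOfPred.2 (Measurable.and (Measurable.forall fun i => ?_) ?_) <;>
        exact measurableSet_setOfPred.1 (measurableSet_le (by fun_prop) (by fun_prop))
    refine (volume_preserving_pi (f := fun i x => cond (s i) x (-x)) fun i => ?_).measure_preimage
      hPm.nullMeasurableSet
    cases s i
    · exact Measure.measurePreserving_neg volume
    · exact MeasurePreserving.id volume
  have h2 : ENNReal.ofReal (2 ^ d / d.factorial) ≤ 2 ^ d * volume P := by
    rw [← h1]
    refine (measure_mono hcov).trans ((measure_iUnion_le _).trans ?_)
    simp [heach]
  have h3 : ENNReal.ofReal (2 ^ d / d.factorial) = 2 ^ d * ENNReal.ofReal (1 / d.factorial) := by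
    rw [div_eq_mul_one_div, ENNReal.ofReal_mul (by positivity), ENNReal.ofReal_pow (by norm_num)]
    norm_num
  rw [h3] at h2
  exact (ENNReal.mul_le_mul_iff_right (by simp) (by finiteness)).1 h2

lemma volume_homDet_update_le {d : ℕ} (hd : 0 < d) (p : Fin (d + 1) → Fin d → ℝ)
    (hp : homDet p ≠ 0) :
    volume {y | ∀ i, |homDet (Function.update p i y)| ≤ |homDet p|} ≤
      2 ^ (d - 1) * ENNReal.ofReal |homDet p| := by
  rw [volume_eq_homDet_mul p hp, mul_comm]
  gcongr
  refine (measure_mono ?_).trans (volume_half_cube_le hd)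
  intro l hl
  simp only [Set.mem_ofPred_eq, homDet_update_baryc, abs_mul] at hl ⊢
  have h : ∀ i, |(Fin.snoc l (1 - ∑ i, l i) : Fin (d + 1) → ℝ) i| ≤ 1 := fun i =>
    le_of_mul_le_mul_right (by simpa using hl i) (abs_pos.2 hp)
  refine ⟨fun i => by simpa using h i.castSucc, ?_⟩
  have := (abs_le.1 (h (Fin.last d))).2
  rw [Fin.snoc_last] at this
  linarith

lemma le_volume_homDet_update_nonneg {d : ℕ} (p : Fin (d + 1) → Fin d → ℝ)
    (hp : homDet p ≠ 0) :
    ENNReal.ofReal (|homDet p| / d.factorial) ≤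
      volume {y | ∀ i, 0 ≤ homDet (Function.update p i y) * homDet p} := by
  rw [volume_eq_homDet_mul p hp, div_eq_mul_one_div, ENNReal.ofReal_mul (abs_nonneg _)]
  gcongr
  refine (inv_factorial_le_volume_simplex d).trans (measure_mono ?_)
  rintro l ⟨h0, h1⟩ i
  rw [homDet_update_baryc, mul_assoc]
  refine mul_nonneg ?_ (mul_self_nonneg _)
  refine Fin.lastCases ?_ (fun i => ?_) i
  · rw [Fin.snoc_last]; linarith
  · rw [Fin.snoc_castSucc]; exact h0 i

lemma integral_pow_mul_one_sub_pow (j m : ℕ) :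
    ∫ s in (0 : ℝ)..1, s ^ j * (1 - s) ^ m =
      j.factorial * m.factorial / (j + m + 1).factorial := by
  induction j generalizing m with
  | zero =>
    have h := intervalIntegral.integral_comp_sub_left (fun s : ℝ => s ^ m) (a := 0) (b := 1) 1
    simp only [pow_zero, one_mul, h]
    simp only [sub_self, sub_zero, integral_pow, Nat.factorial_zero, zero_add, Nat.factorial_succ]
    push_cast
    have : (m.factorial : ℝ) ≠ 0 := by positivity
    field_simp
    simp
  | succ j ih =>
    have hu : ∀ x ∈ Set.uIcc (0 : ℝ) 1, HasDerivAt (fun s : ℝ => s ^ (j + 1))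
        ((j + 1 : ℕ) * x ^ j) x := fun x _ => by simpa using hasDerivAt_pow (j + 1) x
    have hv : ∀ x ∈ Set.uIcc (0 : ℝ) 1, HasDerivAt
        (fun s : ℝ => -((1 - s) ^ (m + 1) / (m + 1))) ((1 - x) ^ m) x := fun x _ => by
      have := (((hasDerivAt_id x).const_sub 1).pow (m + 1)).div_const ((m : ℝ) + 1) |>.neg
      refine this.congr_deriv ?_
      have : (m : ℝ) + 1 ≠ 0 := by positivity
      simp
      field_simp
    rw [intervalIntegral.integral_mul_deriv_eq_deriv_mul hu hv
      (Continuous.intervalIntegrable (by fun_prop) _ _)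
      (Continuous.intervalIntegrable (by fun_prop) _ _)]
    have : (fun x : ℝ => ((j + 1 : ℕ) : ℝ) * x ^ j * -((1 - x) ^ (m + 1) / (m + 1))) =
        fun x => (-((j + 1) / (m + 1)) : ℝ) * (x ^ j * (1 - x) ^ (m + 1)) := by
      ext x; push_cast; ring
    rw [this, intervalIntegral.integral_const_mul, ih]
    have h1 : (j + (m + 1) + 1).factorial = (j + 1 + m + 1).factorial := by congr 1; ring
    rw [h1, Nat.factorial_succ j, Nat.factorial_succ m]
    have : (m : ℝ) + 1 ≠ 0 := by positivity
    push_cast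
    simp
    field_simp

/-- The weight of a simplex with homogeneous determinant `u`. -/
noncomputable def simplexWeight (c f : ℝ) (j m : ℕ) (u : ℝ) : ENNReal :=
  (Set.Icc (-f) f).indicator (fun u => ENNReal.ofReal ((c * |u|) ^ j * (1 - |u| / f) ^ m)) u

lemma measurable_simplexWeight (c f : ℝ) (j m : ℕ) : Measurable (simplexWeight c f j m) :=
  Measurable.indicator (by fun_prop) measurableSet_Icc

lemma lintegral_simplexWeight {c f : ℝ} (hc : 0 ≤ c) (hf : 0 < f) (j m : ℕ) :
    ∫⁻ u, simplexWeight c f j m u = ENNReal.ofReal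
      (2 * (f * (c * f) ^ j * (j.factorial * m.factorial / (j + m + 1).factorial))) := by
  unfold simplexWeight
  have hcont : Continuous fun u : ℝ => (c * |u|) ^ j * (1 - |u| / f) ^ m := by fun_prop
  rw [lintegral_indicator measurableSet_Icc, ← ofReal_integral_eq_lintegral_ofReal
    (hcont.integrableOn_Icc), integral_Icc_eq_integral_Ioc,
    ← intervalIntegral.integral_of_le (by linarith)]
  · congr 1
    rw [← intervalIntegral.integral_add_adjacent_intervals (b := 0)
      (hcont.intervalIntegrable _ _) (hcont.intervalIntegrable _ _)]
    have h1 : ∫ u in (-f)..0, (c * |u|) ^ j * (1 - |u| / f) ^ m =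
        ∫ u in (0 : ℝ)..f, (c * |u|) ^ j * (1 - |u| / f) ^ m := by
      have := intervalIntegral.integral_comp_neg
        (fun u : ℝ => (c * |u|) ^ j * (1 - |u| / f) ^ m) (a := 0) (b := f)
      simpa using this.symm
    have h2 : ∫ u in (0 : ℝ)..f, (c * |u|) ^ j * (1 - |u| / f) ^ m =
        f * ∫ s in (0 : ℝ)..1, (c * |f * s|) ^ j * (1 - |f * s| / f) ^ m := by
      have := intervalIntegral.mul_integral_comp_mul_left
        (f := fun u : ℝ => (c * |u|) ^ j * (1 - |u| / f) ^ m) (a := 0) (b := 1) f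
      simpa using this.symm
    have h3 : ∫ s in (0 : ℝ)..1, (c * |f * s|) ^ j * (1 - |f * s| / f) ^ m =
        ∫ s in (0 : ℝ)..1, (c * f) ^ j * (s ^ j * (1 - s) ^ m) := by
      refine intervalIntegral.integral_congr fun s hs => ?_
      rw [Set.uIcc_of_le zero_le_one] at hs
      simp only [abs_mul, abs_of_pos hf, abs_of_nonneg hs.1, mul_div_cancel_left₀ s hf.ne']
      ring
    rw [h1, h2, h3, intervalIntegral.integral_const_mul, integral_pow_mul_one_sub_pow]
    ring
  · refine (ae_restrict_iff' measurableSet_Icc).2 (ae_of_all _ fun u hu => ?_)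
    have : |u| / f ≤ 1 := (div_le_one hf).2 (abs_le.2 hu)
    have : 0 ≤ 1 - |u| / f := by linarith
    simp only [Pi.zero_apply]
    positivity

lemma lintegral_comp_mul_add {g : ℝ → ENNReal} (hg : Measurable g) {D : ℝ} (hD : D ≠ 0) (c : ℝ) :
    ∫⁻ t, g (t * D + c) = ENNReal.ofReal |D⁻¹| * ∫⁻ u, g u := by
  have h := lintegral_map (μ := volume) (f := fun u => g (u + c)) (g := (· * D))
    (by fun_prop) (by fun_prop)
  rw [← h, Real.map_volume_mul_right hD, lintegral_smul_measure, lintegral_add_right_eq_self,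
    smul_eq_mul]

/-- Integrating a function of the homogeneous determinant over the position of one vertex, when the
projection of that vertex is controlled by the opposite facet. -/
lemma lintegral_homDet_cons_le {c : ℕ} (hc : 0 < c) (a : Fin (c + 1) → Fin (c + 1) → ℝ)
    (ha : homDet (fun i => Fin.tail (a i)) ≠ 0) {g : ℝ → ENNReal} (hg : Measurable g) :
    ∫⁻ x, {x : Fin (c + 1) → ℝ | ∀ i, |homDet (Function.update (fun i => Fin.tail (a i)) i
        (Fin.tail x))| ≤ |homDet (fun i => Fin.tail (a i))|}.indicator
        (fun x => g (homDet (Fin.cons x a : Fin (c + 2) → Fin (c + 1) → ℝ))) x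
      ≤ 2 ^ (c - 1) * ∫⁻ u, g u := by
  set D := homDet fun i => Fin.tail (a i)
  obtain ⟨q, hq, hdet⟩ := exists_homDet_cons a
  set B : Set (Fin c → ℝ) :=
    {y | ∀ i, |homDet (Function.update (fun i => Fin.tail (a i)) i y)| ≤ |D|}
  have hB : MeasurableSet B := by
    refine measurableSet_setOfPred.2 (Measurable.forall fun i =>
      measurableSet_setOfPred.1 (measurableSet_le ?_ measurable_const))
    exact (Continuous.homDet (by fun_prop)).abs.measurable
  have hmp := (volume_preserving_piFinSuccAbove (fun _ : Fin (c + 1) => ℝ) 0).symm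
  rw [← hmp.lintegral_comp_emb (MeasurableEquiv.measurableEmbedding _)]
  simp only [MeasurableEquiv.piFinSuccAbove_symm_apply]
  have hpt : ∀ z : ℝ × (Fin c → ℝ), {x : Fin (c + 1) → ℝ | ∀ i,
      |homDet (Function.update (fun i => Fin.tail (a i)) i (Fin.tail x))| ≤ |D|}.indicator
        (fun x => g (homDet (Fin.cons x a : Fin (c + 2) → Fin (c + 1) → ℝ)))
        (Fin.insertNthEquiv (fun _ => ℝ) 0 z) = B.indicator (fun y => g (z.1 * D + q y)) z.2 := by
    rintro ⟨t, y⟩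
    have hz : (Fin.insertNthEquiv (fun _ => ℝ) 0 (t, y) : Fin (c + 1) → ℝ) = Fin.cons t y := by
      rw [Fin.insertNthEquiv_zero]
      rfl
    rw [hz]
    by_cases hy : y ∈ B
    · rw [Set.indicator_of_mem hy, Set.indicator_of_mem, hdet]
      simpa [B] using hy
    · rw [Set.indicator_of_notMem hy, Set.indicator_of_notMem]
      simpa [B] using hy
  simp only [hpt]
  rw [Measure.volume_eq_prod, lintegral_prod_symm]
  · have : ∀ y : Fin c → ℝ, ∫⁻ t : ℝ, B.indicator (fun y => g (t * D + q y)) y =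
        B.indicator (fun _ => ENNReal.ofReal |D⁻¹| * ∫⁻ u, g u) y := by
      intro y
      by_cases hy : y ∈ B
      · simp only [Set.indicator_of_mem hy]
        exact lintegral_comp_mul_add hg ha _
      · simp [Set.indicator_of_notMem hy]
    simp only [this]
    rw [lintegral_indicator hB, setLIntegral_const]
    calc _ ≤ (ENNReal.ofReal |D⁻¹| * ∫⁻ u, g u) * (2 ^ (c - 1) * ENNReal.ofReal |D|) := by
          gcongr
          exact volume_homDet_update_le hc _ ha
      _ = (ENNReal.ofReal |D⁻¹| * ENNReal.ofReal |D|) * (2 ^ (c - 1) * ∫⁻ u, g u) := by ring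
      _ = _ := by
          rw [← ENNReal.ofReal_mul (abs_nonneg _), abs_inv, inv_mul_cancel₀ (abs_ne_zero.2 ha),
            ENNReal.ofReal_one, one_mul]
  · refine Measurable.aemeasurable ?_
    have : (fun z : ℝ × (Fin c → ℝ) => B.indicator (fun y => g (z.1 * D + q y)) z.2) =
        (Prod.snd ⁻¹' B).indicator (fun z : ℝ × (Fin c → ℝ) => g (z.1 * D + q z.2)) := by
      ext z
      simp only [Set.indicator, Set.mem_preimage]
    rw [this]
    exact Measurable.indicator (by fun_prop) (measurable_snd hB)

lemma measurePreserving_comp_prod_compl {ι α X : Type*} [Fintype ι] [Fintype α]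
    [MeasurableSpace X] (ν : Measure X) [SigmaFinite ν] {τ : ι → α} (hτ : Function.Injective τ)
    [Fintype ↥(Set.range τ)ᶜ] :
    MeasurePreserving (fun S : α → X => ((fun i => S (τ i)), fun r : ↥(Set.range τ)ᶜ => S r))
      (Measure.pi fun _ => ν) ((Measure.pi fun _ => ν).prod (Measure.pi fun _ => ν)) := by
  classical
  let e : ι ⊕ ↥(Set.range τ)ᶜ ≃ α :=
    (Equiv.sumCongr (Equiv.ofInjective τ hτ) (Equiv.refl _)).trans (Equiv.Set.sumCompl _)
  have h1 := (measurePreserving_piCongrLeft (fun _ : α => ν) e).symm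
  have h2 := measurePreserving_sumPiEquivProdPi (fun _ : ι ⊕ ↥(Set.range τ)ᶜ => ν)
  exact h2.comp h1

lemma exists_weights_of_homDet_nonneg {d : ℕ} {p : Fin (d + 1) → Fin d → ℝ} (hp : homDet p ≠ 0)
    {y : Fin d → ℝ} (hy : ∀ i, 0 ≤ homDet (Function.update p i y) * homDet p) :
    ∃ w : Fin (d + 1) → ℝ, (∀ i, 0 ≤ w i) ∧ ∑ i, w i = 1 ∧ ∑ i, w i • p i = y := by
  obtain ⟨h1, h2⟩ := homDet_smul_eq_sum p y
  refine ⟨fun i => homDet (Function.update p i y) / homDet p, fun i => ?_, ?_, ?_⟩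
  · simp only
    rw [← mul_div_mul_right _ _ hp]
    exact div_nonneg (hy i) (mul_self_nonneg _)
  · rw [← Finset.sum_div, h1, div_self hp]
  · ext j
    simp only [Finset.sum_apply, Pi.smul_apply, smul_eq_mul, div_mul_eq_mul_div]
    rw [← Finset.sum_div, h2, mul_div_cancel_left₀ _ hp]

/-- The simplex `p` is nondegenerate with vertices in `K`, and the projection of its facet opposite
to the vertex `p 0` dominates those of the facets through `p 0`. -/
def IsAdapted {c : ℕ} (K : Set (Fin (c + 1) → ℝ)) (p : Fin (c + 2) → Fin (c + 1) → ℝ) : Prop :=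
  homDet (fun i => Fin.tail (p (Fin.succ i))) ≠ 0 ∧ homDet p ≠ 0 ∧
  (∀ i, |homDet (Function.update (fun i => Fin.tail (p (Fin.succ i))) i (Fin.tail (p 0)))| ≤
    |homDet (fun i => Fin.tail (p (Fin.succ i)))|) ∧
  ∀ i, p i ∈ K

/-- The points `p` form an adapted simplex, the points `s r` with `r ∈ J` cannot replace
a vertex of the simplex to increase its volume, and the other points `s r` are not in it. -/
def adaptedSet {c : ℕ} {κ : Type*} (K : Set (Fin (c + 1) → ℝ)) (J : Set κ) :
    Set ((Fin (c + 2) → Fin (c + 1) → ℝ) × (κ → Fin (c + 1) → ℝ)) :=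
  {z | IsAdapted K z.1 ∧ ∀ r,
    (r ∈ J → ∀ i, |homDet (Function.update z.1 i (z.2 r))| ≤ |homDet z.1|) ∧
    (r ∉ J → ¬ ∀ i, 0 ≤ homDet (Function.update z.1 i (z.2 r)) * homDet z.1)}

lemma measurable_isAdapted {c : ℕ} {K : Set (Fin (c + 1) → ℝ)} (hK : MeasurableSet K) :
    Measurable fun p : Fin (c + 2) → Fin (c + 1) → ℝ => IsAdapted K p := by
  have h1 : Measurable fun p : Fin (c + 2) → Fin (c + 1) → ℝ =>
      homDet (fun i => Fin.tail (p (Fin.succ i))) := by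
    refine (Continuous.homDet ?_).measurable
    unfold Fin.tail; fun_prop
  have h2 : Measurable fun p : Fin (c + 2) → Fin (c + 1) → ℝ => homDet p :=
    (Continuous.homDet continuous_id).measurable
  refine Measurable.and (measurableSet_setOfPred.1 (h1 (measurableSet_singleton 0).compl))
    (Measurable.and (measurableSet_setOfPred.1 (h2 (measurableSet_singleton 0).compl))
    (Measurable.and (Measurable.forall fun i => measurableSet_setOfPred.1
      (measurableSet_le ?_ h1.abs)) (Measurable.forall fun i =>
        measurableSet_setOfPred.1 (measurable_pi_apply i hK))))
  refine (Continuous.homDet ?_).abs.measurable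
  unfold Fin.tail; fun_prop

lemma measurableSet_adaptedSet {c : ℕ} {κ : Type*} [Countable κ] {K : Set (Fin (c + 1) → ℝ)}
    (hK : MeasurableSet K) (J : Set κ) : MeasurableSet (adaptedSet K J) := by
  have h2 : Measurable fun z : (Fin (c + 2) → Fin (c + 1) → ℝ) × (κ → Fin (c + 1) → ℝ) =>
      homDet z.1 := (Continuous.homDet continuous_fst).measurable
  have h3 : ∀ r i, Measurable fun z : (Fin (c + 2) → Fin (c + 1) → ℝ) × (κ → Fin (c + 1) → ℝ) =>
      homDet (Function.update z.1 i (z.2 r)) := fun r i =>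
    (Continuous.homDet (by fun_prop)).measurable
  refine measurableSet_setOfPred.2 (Measurable.and ((measurable_isAdapted hK).comp measurable_fst)
    (Measurable.forall fun r => Measurable.and (Measurable.imp measurable_const
      (Measurable.forall fun i => measurableSet_setOfPred.1 (measurableSet_le (h3 r i).abs h2.abs)))
      (Measurable.imp measurable_const (Measurable.not (Measurable.forall fun i =>
        measurableSet_setOfPred.1 (measurableSet_le measurable_const ((h3 r i).mul h2)))))))

lemma pi_adaptedSet_slice_le {c : ℕ} {κ : Type*} [Fintype κ] {K : Set (Fin (c + 1) → ℝ)}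
    (hKconv : Convex ℝ K) (hKvol : volume K = 1) (J : Finset κ)
    (p : Fin (c + 2) → Fin (c + 1) → ℝ) :
    (Measure.pi fun _ : κ => volume.restrict K) (Prod.mk p ⁻¹' adaptedSet K J) ≤
      {p | IsAdapted K p}.indicator (fun p => simplexWeight (2 ^ c) (c + 1).factorial J.card
        (Fintype.card κ - J.card) (homDet p)) p := by
  classical
  by_cases hp : IsAdapted K p
  swap
  · rw [Set.indicator_of_notMem (by exact hp)]
    refine le_of_eq (measure_mono_null (t := ∅) ?_ measure_empty)
    intro s hs
    exact hp hs.1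
  rw [Set.indicator_of_mem (by exact hp)]
  obtain ⟨-, hdet, -, hmem⟩ := hp
  set R : Set (Fin (c + 1) → ℝ) := {y | ∀ i, |homDet (Function.update p i y)| ≤ |homDet p|}
  set T : Set (Fin (c + 1) → ℝ) := {y | ∀ i, 0 ≤ homDet (Function.update p i y) * homDet p}
  have hTm : MeasurableSet T := by
    refine measurableSet_setOfPred.2 (Measurable.forall fun i => measurableSet_setOfPred.1
      (measurableSet_le measurable_const (Measurable.mul_const ?_ _)))
    exact (Continuous.homDet (by fun_prop)).measurable
  have hTK : T ⊆ K := by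
    intro y hy
    obtain ⟨w, hw0, hw1, rfl⟩ := exists_weights_of_homDet_nonneg hdet hy
    exact hKconv.sum_mem (fun i _ => hw0 i) hw1 fun i _ => hmem i
  have hTvol := le_volume_homDet_update_nonneg p hdet
  have hf : (0 : ℝ) < (c + 1).factorial := by positivity
  have hle : |homDet p| / (c + 1).factorial ≤ 1 := by
    have := hTvol.trans ((measure_mono hTK).trans hKvol.le)
    rwa [ENNReal.ofReal_le_one] at this
  have hTc : (volume.restrict K) Tᶜ ≤
      ENNReal.ofReal (1 - |homDet p| / (c + 1).factorial) := by
    rw [Measure.restrict_apply hTm.compl, Set.inter_comm, ← Set.sdiff_eq,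
      measure_sdiff hTK hTm.nullMeasurableSet (ne_top_of_le_ne_top (by rw [hKvol]; simp)
        (measure_mono hTK)), hKvol, ENNReal.ofReal_sub _ (by positivity), ENNReal.ofReal_one]
    exact tsub_le_tsub_left hTvol _
  have hR : (volume.restrict K) R ≤ ENNReal.ofReal (2 ^ c * |homDet p|) := by
    refine (Measure.restrict_apply_le _ _).trans
      ((volume_homDet_update_le c.succ_pos p hdet).trans (le_of_eq ?_))
    rw [ENNReal.ofReal_mul (by positivity), ENNReal.ofReal_pow (by norm_num)]
    norm_num
  have hsub : Prod.mk p ⁻¹' adaptedSet K (J : Set κ) ⊆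
      Set.univ.pi fun r => if r ∈ J then R else Tᶜ := by
    intro s hs r _
    simp only
    by_cases hr : r ∈ J
    · rw [if_pos hr]; exact (hs.2 r).1 hr
    · rw [if_neg hr]; exact (hs.2 r).2 hr
  refine (measure_mono hsub).trans ?_
  rw [Measure.pi_pi]
  calc _ ≤ ∏ r : κ, (if r ∈ J then ENNReal.ofReal (2 ^ c * |homDet p|) else
        ENNReal.ofReal (1 - |homDet p| / (c + 1).factorial)) := by
        refine Finset.prod_le_prod' fun r _ => ?_
        split_ifs
        exacts [hR, hTc]
    _ = ENNReal.ofReal (2 ^ c * |homDet p|) ^ J.card *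
        ENNReal.ofReal (1 - |homDet p| / (c + 1).factorial) ^ (Fintype.card κ - J.card) := by
        rw [Finset.prod_ite, Finset.prod_const, Finset.prod_const]
        congr 2
        · congr 1; ext; simp
        · rw [← Finset.card_compl]; congr 1; ext; simp
    _ ≤ _ := by
        have hmem : homDet p ∈ Set.Icc (-((c + 1).factorial : ℝ)) (c + 1).factorial :=
          abs_le.1 ((div_le_one hf).1 hle)
        rw [simplexWeight, Set.indicator_of_mem hmem,
          ← ENNReal.ofReal_pow (by positivity), ← ENNReal.ofReal_pow (by linarith),
          ← ENNReal.ofReal_mul (by positivity)]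

lemma measure_adaptedSet_le {c : ℕ} (hc : 0 < c) {K : Set (Fin (c + 1) → ℝ)}
    (hK : MeasurableSet K) (hKconv : Convex ℝ K) (hKvol : volume K = 1)
    {κ : Type*} [Fintype κ] (J : Finset κ) :
    ((Measure.pi fun _ : Fin (c + 2) => volume.restrict K).prod
      (Measure.pi fun _ : κ => volume.restrict K)) (adaptedSet K J) ≤
    ENNReal.ofReal (2 ^ c * ((c + 1).factorial * (2 ^ c * (c + 1).factorial) ^ J.card *
      (J.card.factorial * (Fintype.card κ - J.card).factorial /
        (Fintype.card κ + 1).factorial))) := by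
  have : IsProbabilityMeasure (volume.restrict K) := ⟨by simp [hKvol]⟩
  rw [Measure.prod_apply (measurableSet_adaptedSet hK _)]
  refine (lintegral_mono (pi_adaptedSet_slice_le hKconv hKvol J)).trans ?_
  set m := Fintype.card κ - J.card
  set g := simplexWeight (2 ^ c) (c + 1).factorial J.card m
  have hg : Measurable g := measurable_simplexWeight _ _ _ _
  have hmeas : Measurable ({p | IsAdapted K p}.indicator fun p => g (homDet p)) :=
    Measurable.indicator (hg.comp (Continuous.homDet continuous_id).measurable)
      (measurableSet_setOfPred.2 (measurable_isAdapted hK))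
  have hmp := (measurePreserving_piFinSuccAbove
    (fun _ : Fin (c + 2) => (volume.restrict K : Measure (Fin (c + 1) → ℝ))) 0).symm
  rw [← hmp.lintegral_comp_emb (MeasurableEquiv.measurableEmbedding _),
    lintegral_prod_symm _ (by fun_prop)]
  have hinner : ∀ a : Fin (c + 1) → Fin (c + 1) → ℝ,
      ∫⁻ x in K, {p | IsAdapted K p}.indicator (fun p => g (homDet p))
        ((MeasurableEquiv.piFinSuccAbove (fun _ => Fin (c + 1) → ℝ) 0).symm (x, a)) ≤
      2 ^ (c - 1) * ∫⁻ u, g u := by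
    intro a
    refine (setLIntegral_le_lintegral _ _).trans ?_
    by_cases ha : homDet (fun i => Fin.tail (a i)) = 0
    · refine le_trans (le_of_eq ?_) zero_le
      refine (lintegral_eq_zero_iff' (by fun_prop)).2 (ae_of_all _ fun x => ?_)
      refine Set.indicator_of_notMem ?_ _
      intro h
      exact h.1 ha
    · refine le_trans (lintegral_mono fun x => ?_) (lintegral_homDet_cons_le hc a ha hg)
      have hx : (MeasurableEquiv.piFinSuccAbove (fun _ => Fin (c + 1) → ℝ) 0).symm (x, a) =
          (Fin.cons x a : Fin (c + 2) → Fin (c + 1) → ℝ) := by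
        rw [MeasurableEquiv.piFinSuccAbove_symm_apply, Fin.insertNthEquiv_zero]
        rfl
      rw [hx]
      by_cases h : IsAdapted K (Fin.cons x a : Fin (c + 2) → Fin (c + 1) → ℝ)
      · rw [Set.indicator_of_mem (by exact h), Set.indicator_of_mem]
        simpa using h.2.2.1
      · rw [Set.indicator_of_notMem (by exact h)]
        exact zero_le
  refine (lintegral_mono hinner).trans ?_
  rw [lintegral_const, measure_univ, mul_one, lintegral_simplexWeight (by positivity)
    (by positivity)]
  have hm : J.card + m + 1 = Fintype.card κ + 1 := by
    have := J.card_le_univ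
    omega
  have h2 : (2 : ENNReal) ^ (c - 1) = ENNReal.ofReal (2 ^ (c - 1)) := by
    rw [ENNReal.ofReal_pow (by norm_num)]; norm_num
  rw [h2, ← ENNReal.ofReal_mul (by positivity), hm]
  refine le_of_eq ?_
  congr 1
  obtain ⟨b, rfl⟩ : ∃ b, c = b + 1 := ⟨c - 1, by omega⟩
  simp only [Nat.add_sub_cancel]
  ring

/-- A measurable set that meets every line in a fixed direction in a null set is null. -/
lemma measure_eq_zero_of_forall_line {V : Type*} [AddCommGroup V] [Module ℝ V] [MeasurableSpace V]
    [MeasurableAdd₂ V] [MeasurableSMul ℝ V]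
    (μ : Measure V) [SigmaFinite μ] [μ.IsAddRightInvariant] {Z : Set V} (hZ : MeasurableSet Z)
    (w : V) (h : ∀ v, volume {t : ℝ | v + t • w ∈ Z} = 0) : μ Z = 0 := by
  have hm : MeasurableSet {z : ℝ × V | z.2 + z.1 • w ∈ Z} := by
    have : Measurable fun z : ℝ × V => z.2 + z.1 • w := by fun_prop
    exact this hZ
  have h1 := Measure.prod_apply (μ := (volume : Measure ℝ)) (ν := μ) hm
  have h2 := Measure.prod_apply_symm (μ := (volume : Measure ℝ)) (ν := μ) hm
  have h3 : ∀ v : V, volume ((fun t : ℝ => (t, v)) ⁻¹' {z : ℝ × V | z.2 + z.1 • w ∈ Z}) = 0 :=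
    h
  have h4 : ∀ t : ℝ, μ (Prod.mk t ⁻¹' {z : ℝ × V | z.2 + z.1 • w ∈ Z}) = μ Z := fun t =>
    measure_preimage_add_right μ (t • w) Z
  simp only [h3, lintegral_zero] at h2
  simp only [h4, h2, lintegral_const, Real.volume_univ] at h1
  simpa using h1.symm

lemma ae_homDet_ne_zero {n d : ℕ} (K : Set (Fin d → ℝ)) (τ : Fin (d + 1) → Fin n)
    (hτ : Function.Injective τ) :
    ∀ᵐ S ∂(Measure.pi fun _ : Fin n => volume.restrict K), homDet (fun i => S (τ i)) ≠ 0 := by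
  rw [← Measure.restrict_pi_pi]
  refine ae_restrict_of_ae ?_
  have hc : Continuous fun S : Fin n → Fin d → ℝ => homDet fun i => S (τ i) :=
    Continuous.homDet (by fun_prop)
  refine measure_eq_zero_of_forall_line (V := Fin n → Fin d → ℝ) volume
    (Z := {S | ¬ homDet (fun i => S (τ i)) ≠ 0})
    (measurableSet_setOfPred.2 (Measurable.not (measurableSet_setOfPred.1
      (hc.measurable (measurableSet_singleton 0).compl))))
    (fun q j => if q = τ j.castSucc then 1 else 0) fun v => ?_
  set L : Matrix (Fin d) (Fin d) ℝ :=
    Matrix.of fun i j => v (τ i.castSucc) j - v (τ (Fin.last d)) j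
  have hpoly : ∀ t : ℝ, homDet (fun i => (v + t • fun (q : Fin n) (j : Fin d) =>
      if q = τ j.castSucc then (1 : ℝ) else 0) (τ i)) = (-L).charpoly.eval t := by
    intro t
    rw [Matrix.eval_charpoly, homDet_eq_det_sub]
    congr 1
    ext i j
    simp only [Matrix.of_apply, Pi.add_apply, Pi.smul_apply, smul_eq_mul, hτ.eq_iff,
      Fin.castSucc_inj, (Fin.castSucc_lt_last j).ne', L, Matrix.scalar_apply, Matrix.sub_apply,
      Matrix.neg_apply, Matrix.diagonal_apply, if_false]
    split_ifs <;> ring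
  have hset : {t : ℝ | (v + t • fun (q : Fin n) (j : Fin d) => if q = τ j.castSucc then (1 : ℝ)
      else 0) ∈ {S : Fin n → Fin d → ℝ | ¬ homDet (fun i => S (τ i)) ≠ 0}} =
      {t | (-L).charpoly.IsRoot t} := by
    ext t
    simp only [Set.mem_ofPred_eq, not_not, hpoly, Polynomial.IsRoot]
  rw [hset]
  exact (Polynomial.finite_setOfPred_isRoot (Matrix.charpoly_monic _).ne_zero).measure_zero _

lemma exists_perm_comp_eq {X : Type*} {m : ℕ} {f g : Fin m → X} (hg : Function.Injective g)
    (h : ∀ i, g i ∈ Set.range f) : ∃ σ : Equiv.Perm (Fin m), g = f ∘ σ := by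
  choose ρ hρ using h
  have hinj : Function.Injective ρ := fun i j hij => hg (by rw [← hρ, ← hρ, hij])
  exact ⟨Equiv.ofBijective ρ (Finite.injective_iff_bijective.1 hinj), funext fun i => (hρ i).symm⟩

/-- The injective enumerations of subsets of `I` of size `m + 1` in increasing order, except for the
first element. -/
def pointedFrames {n : ℕ} (m : ℕ) (I : Finset (Fin n)) : Finset (Fin (m + 1) → Fin n) :=
  open Classical in Finset.univ.filter fun τ =>
    StrictMono (fun i : Fin m => τ i.succ) ∧ Function.Injective τ ∧ ∀ i, τ i ∈ I

lemma card_pointedFrames_le {n m : ℕ} (I : Finset (Fin n)) :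
    (pointedFrames m I).card ≤ I.card.choose m * (I.card - m) := by
  classical
  have h : (pointedFrames m I).card ≤ ((I.powersetCard m).sigma fun A => I \ A).card := by
    refine Finset.card_le_card_of_injOn
      (fun τ => ⟨Finset.univ.image fun i : Fin m => τ i.succ, τ 0⟩) ?_ ?_
    · intro τ hτ
      simp only [pointedFrames, Finset.coe_filter, Finset.mem_univ, true_and,
        Set.mem_ofPred_eq] at hτ
      obtain ⟨hmono, hinj, hI⟩ := hτ
      simp only [Finset.coe_sigma, Set.mem_sigma_iff, Finset.mem_coe, Finset.mem_powersetCard,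
        Finset.mem_sdiff, Finset.mem_image, Finset.mem_univ, true_and, not_exists]
      refine ⟨⟨fun q hq => ?_, ?_⟩, hI 0, fun i hi => ?_⟩
      · obtain ⟨i, -, rfl⟩ := Finset.mem_image.1 hq
        exact hI _
      · rw [Finset.card_image_of_injective _ hmono.injective, Finset.card_univ, Fintype.card_fin]
      · exact Fin.succ_ne_zero i (hinj hi)
    · intro τ hτ τ' hτ' heq
      simp only [pointedFrames, Finset.coe_filter, Finset.mem_univ, true_and,
        Set.mem_ofPred_eq] at hτ hτ'
      simp only [Sigma.mk.injEq, heq_eq_eq] at heq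
      have hr := congrArg (fun A : Finset (Fin n) => (A : Set (Fin n))) heq.1
      simp only [Finset.coe_image, Finset.coe_univ, Set.image_univ] at hr
      have := (StrictMono.range_inj hτ.1 hτ'.1).1 hr
      ext i
      refine Fin.cases ?_ (fun i => ?_) i
      · rw [heq.2]
      · exact congrArg Fin.val (congrFun this i)
  refine h.trans (le_of_eq ?_)
  rw [Finset.card_sigma, Finset.sum_congr rfl (g := fun _ => I.card - m), Finset.sum_const,
    Finset.card_powersetCard, smul_eq_mul]
  intro A hA
  rw [Finset.mem_powersetCard] at hA
  rw [Finset.card_sdiff_of_subset hA.1, hA.2]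

/-- The configurations in which `τ` enumerates an adapted simplex among the points indexed by `I`
that contains no point of the configuration with an index outside of `I`. -/
def frameEvent {n c : ℕ} (K : Set (Fin (c + 1) → ℝ)) (I : Finset (Fin n))
    (τ : Fin (c + 2) → Fin n) : Set (Fin n → Fin (c + 1) → ℝ) :=
  (fun S => ((fun i => S (τ i)), fun r : ↥(Set.range τ)ᶜ => S r)) ⁻¹'
    adaptedSet K {r : ↥(Set.range τ)ᶜ | (r : Fin n) ∈ I}

lemma exists_mem_frameEvent {n c : ℕ} {K : Set (Fin (c + 1) → ℝ)}
    {S : Fin n → EuclideanSpace ℝ (Fin (c + 1))} (hSK : ∀ q, (S q).ofLp ∈ K)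
    (hgen : ∀ τ : Fin (c + 2) → Fin n, Function.Injective τ →
      homDet (fun i => (S (τ i)).ofLp) ≠ 0)
    {I : Finset (Fin n)} (hI : c + 2 ≤ I.card)
    (hisl : ∀ q, S q ∈ convexHull ℝ (S '' I) → q ∈ I) :
    ∃ τ ∈ pointedFrames (c + 1) I, (fun q => (S q).ofLp) ∈ frameEvent K I τ := by
  classical
  set P : Fin n → Fin (c + 1) → ℝ := fun q => (S q).ofLp
  have hcard : Fintype.card (Fin (c + 2)) ≤ Fintype.card I := by simpa using hI
  obtain ⟨emb⟩ := Function.Embedding.nonempty_of_card_le hcard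
  have : Nonempty (Fin (c + 2) → I) := ⟨emb⟩
  obtain ⟨τ₁, hτ₁⟩ := Finite.exists_max fun τ : Fin (c + 2) → I => |homDet fun i => P (τ i)|
  have hτ₁0 : homDet (fun i => P (τ₁ i)) ≠ 0 := by
    rw [← abs_pos]
    refine lt_of_lt_of_le (abs_pos.2 (hgen (fun i => emb i) ?_)) (hτ₁ emb)
    exact Subtype.val_injective.comp emb.injective
  set τ₀ : Fin (c + 2) → Fin n := fun i => τ₁ i
  have hmax : ∀ τ : Fin (c + 2) → Fin n, (∀ i, τ i ∈ I) →
      |homDet fun i => P (τ i)| ≤ |homDet fun i => P (τ₀ i)| := fun τ h =>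
    hτ₁ fun i => ⟨τ i, h i⟩
  have hτ₀inj : Function.Injective τ₀ := fun i j hij =>
    homDet_ne_zero_injective hτ₁0 (congrArg P hij)
  have : Nonempty (Fin (c + 1) → Fin (c + 2)) := ⟨fun _ => 0⟩
  obtain ⟨a₀, ha₀⟩ := Finite.exists_max fun a : Fin (c + 1) → Fin (c + 2) =>
    |homDet fun i => Fin.tail (P (τ₀ (a i)))|
  have ha₀0 : homDet (fun i => Fin.tail (P (τ₀ (a₀ i)))) ≠ 0 := by
    obtain ⟨j, hj⟩ := exists_homDet_tail_ne_zero _ hτ₁0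
    rw [← abs_pos] at hj ⊢
    exact hj.trans_le (ha₀ j.succAbove)
  have ha₀inj : Function.Injective a₀ := fun i j hij =>
    homDet_ne_zero_injective ha₀0 (by simp only [hij])
  have hcardA : (Finset.univ.image fun i => τ₀ (a₀ i)).card = c + 1 := by
    rw [Finset.card_image_of_injective (f := fun i => τ₀ (a₀ i)) _ (hτ₀inj.comp ha₀inj),
      Finset.card_univ, Fintype.card_fin]
  set a := (Finset.univ.image fun i => τ₀ (a₀ i)).orderEmbOfFin hcardA
  obtain ⟨σ, hσ⟩ : ∃ σ : Equiv.Perm (Fin (c + 1)), a = (fun i => τ₀ (a₀ i)) ∘ σ := by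
    refine exists_perm_comp_eq a.injective fun i => ?_
    have := Finset.orderEmbOfFin_mem _ hcardA i
    obtain ⟨l, -, hl⟩ := Finset.mem_image.1 this
    exact ⟨l, hl⟩
  obtain ⟨z, hz⟩ : ∃ z, z ∉ Set.range a₀ := by
    by_contra! h
    have := Fintype.card_le_of_surjective a₀ h
    simp at this
  set τ : Fin (c + 2) → Fin n := Fin.cons (τ₀ z) a
  have hτinj : Function.Injective τ := by
    refine Fin.cons_injective_iff.2 ⟨?_, a.injective⟩
    rintro ⟨i, hi⟩
    rw [hσ] at hi
    exact hz ⟨_, hτ₀inj hi⟩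
  obtain ⟨ρ, hρ⟩ : ∃ ρ : Equiv.Perm (Fin (c + 2)), τ = τ₀ ∘ ρ := by
    refine exists_perm_comp_eq hτinj fun i => ?_
    refine Fin.cases ⟨z, rfl⟩ (fun i => ?_) i
    simp only [τ, Fin.cons_succ, hσ]
    exact ⟨_, rfl⟩
  have hτI : ∀ i, τ i ∈ I := fun i => by
    rw [hρ]
    exact (τ₁ (ρ i)).2
  have habs : |homDet fun i => P (τ i)| = |homDet fun i => P (τ₀ i)| := by
    rw [hρ]
    exact abs_homDet_comp_equiv (fun i => P (τ₀ i)) ρ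
  have habsa : |homDet fun i => Fin.tail (P (a i))| =
      |homDet fun i => Fin.tail (P (τ₀ (a₀ i)))| := by
    rw [hσ]
    exact abs_homDet_comp_equiv (fun i => Fin.tail (P (τ₀ (a₀ i)))) σ
  have hτ0 : homDet (fun i => P (τ i)) ≠ 0 := hgen τ hτinj
  refine ⟨τ, ?_, ⟨?_, hτ0, fun i => ?_, fun i => hSK _⟩, fun r => ⟨fun hr i => ?_, fun hr h => ?_⟩⟩
  · simp only [pointedFrames, Finset.mem_filter, Finset.mem_univ, true_and]
    refine ⟨?_, hτinj, hτI⟩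
    simp only [τ, Fin.cons_succ]
    exact a.strictMono
  · simp only [τ, Fin.cons_succ]
    rwa [← abs_pos, habsa, abs_pos]
  · simp only [τ, Fin.cons_succ, Fin.cons_zero]
    rw [habsa]
    refine le_of_eq_of_le (congrArg (fun p => |homDet p|) (funext fun l => ?_))
      (ha₀ (Function.update (a₀ ∘ σ) i z))
    by_cases hl : l = i
    · subst hl; simp
    · simp [hl, hσ]
  · simp only
    rw [habs]
    refine le_of_eq_of_le (congrArg (fun p => |homDet p|) (funext fun l => ?_))
      (hmax (Function.update τ i r) fun l => ?_)
    · by_cases hl : l = i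
      · subst hl; simp
      · simp [hl]
    · by_cases hl : l = i
      · subst hl; simpa using hr
      · simpa [hl] using hτI l
  · refine hr (hisl r ?_)
    obtain ⟨w, hw0, hw1, hw⟩ := exists_weights_of_homDet_nonneg hτ0 h
    have hS : S r = ∑ i, w i • S (τ i) := by
      ext j
      have := congrFun hw j
      simpa [P] using this.symm
    rw [hS]
    exact (convex_convexHull ℝ _).sum_mem (fun i _ => hw0 i) hw1 fun i _ =>
      subset_convexHull ℝ _ ⟨τ i, hτI i, rfl⟩

lemma measure_frameEvent_le {n c : ℕ} (hc : 0 < c) {K : Set (Fin (c + 1) → ℝ)}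
    (hK : MeasurableSet K) (hKconv : Convex ℝ K) (hKvol : volume K = 1) {I : Finset (Fin n)}
    {τ : Fin (c + 2) → Fin n} (hτ : Function.Injective τ) (hτI : ∀ i, τ i ∈ I) :
    (Measure.pi fun _ : Fin n => volume.restrict K) (frameEvent K I τ) ≤
      ENNReal.ofReal (2 ^ c * ((c + 1).factorial * (2 ^ c * (c + 1).factorial) ^
        (I.card - (c + 2)) * ((I.card - (c + 2)).factorial * (n - I.card).factorial /
          (n - (c + 2) + 1).factorial))) := by
  classical
  set A : Finset (Fin n) := Finset.univ.image τ
  have hA : A.card = c + 2 := by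
    rw [Finset.card_image_of_injective _ hτ, Finset.card_univ, Fintype.card_fin]
  have hAI : A ⊆ I := by
    intro q hq
    obtain ⟨i, -, rfl⟩ := Finset.mem_image.1 hq
    exact hτI i
  have hmemA : ∀ q, q ∈ A ↔ q ∈ Set.range τ := fun q => by simp [A]
  set J : Finset ↥(Set.range τ)ᶜ := Finset.univ.filter fun r => (r : Fin n) ∈ I
  have hJ : J.card = I.card - (c + 2) := by
    refine Eq.trans ?_ ((Finset.card_sdiff_of_subset hAI).trans (by rw [hA]))
    rw [← Finset.card_map (Function.Embedding.subtype _)]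
    congr 1
    ext q
    simp [J, hmemA, and_comm]
  have hcard : Fintype.card ↥(Set.range τ)ᶜ = n - (c + 2) := by
    rw [Fintype.card_compl_set, Set.card_range_of_injective hτ, Fintype.card_fin, Fintype.card_fin]
  have hAc := Finset.card_le_card hAI
  have hIn := Finset.card_le_univ I
  rw [Fintype.card_fin] at hIn
  have h := measure_adaptedSet_le hc hK hKconv hKvol J
  rw [hJ, hcard, show n - (c + 2) - (I.card - (c + 2)) = n - I.card by omega] at h
  refine le_of_eq_of_le ?_ h
  have : {r : ↥(Set.range τ)ᶜ | (r : Fin n) ∈ I} = (J : Set ↥(Set.range τ)ᶜ) := by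
    ext r; simp [J]
  rw [frameEvent, this, (measurePreserving_comp_prod_compl _ hτ).measure_preimage
    (measurableSet_adaptedSet hK _).nullMeasurableSet]

lemma measurableSet_frameEvent {n c : ℕ} {K : Set (Fin (c + 1) → ℝ)} (hK : MeasurableSet K)
    (I : Finset (Fin n)) (τ : Fin (c + 2) → Fin n) : MeasurableSet (frameEvent K I τ) := by
  have : Measurable fun S : Fin n → Fin (c + 1) → ℝ =>
      ((fun i => S (τ i)), fun r : ↥(Set.range τ)ᶜ => S r) := by fun_prop
  exact this (measurableSet_adaptedSet hK _)

lemma measurePreserving_pi_restrict_ofLp (n d : ℕ) (K : Set (Fin d → ℝ)) (hK : MeasurableSet K) :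
    MeasurePreserving (fun (S : Fin n → EuclideanSpace ℝ (Fin d)) q => (S q).ofLp)
      (Measure.pi fun _ => volume.restrict (WithLp.ofLp ⁻¹' K))
      (Measure.pi fun _ => volume.restrict K) :=
  measurePreserving_pi _ _ fun _ =>
    (PiLp.volume_preserving_ofLp (Fin d)).restrict_preimage hK

lemma choose_mul_choose_mul_factorial {d k n : ℕ} (hd : d < k) (hk : k ≤ n) :
    n.choose k * (k.choose d * (k - d)) * (d.factorial * (k - d - 1).factorial *
      (n - k).factorial) = n.factorial := by
  rw [← Nat.choose_mul_factorial_mul_factorial hk,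
    ← Nat.choose_mul_factorial_mul_factorial hd.le,
    ← Nat.mul_factorial_pred (n := k - d) (by omega)]
  ring

lemma descFactorial_mul_pow_le {d k n : ℕ} (hd : d < k) (hk : k ≤ n) :
    n.descFactorial d * (n - k + 1) ^ (k - d - 1) ≤ n.descFactorial (k - 1) := by
  rw [← Nat.descFactorial_mul_descFactorial (show d ≤ k - 1 by omega), mul_comm,
    show k - 1 - d = k - d - 1 by omega]
  refine Nat.mul_le_mul_right _ (le_trans (Nat.pow_le_pow_left ?_ _)
    (Nat.pow_sub_le_descFactorial _ _))
  omega

lemma two_pow_mul_factorial_le {d : ℕ} (hd : 2 ≤ d) (m : ℕ) (hm : 0 < m) :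
    2 ^ (d - 1) * d.factorial ≤ 2 * d ^ (2 * d - 1) * m := by
  have h : 2 ^ (d - 1) * d.factorial ≤ d ^ (d - 1) * d ^ d :=
    Nat.mul_le_mul (Nat.pow_le_pow_left hd _) (Nat.factorial_le_pow d)
  rw [← pow_add, show d - 1 + d = 2 * d - 1 by omega] at h
  refine (h.trans (Nat.le_mul_of_pos_left _ two_pos)).trans (Nat.le_mul_of_pos_right _ hm)

lemma sum_frame_bound_le {d k n : ℕ} (hd : 2 ≤ d) (hk : d < k) (hn : k ≤ n) :
    ((n.choose k * (k.choose d * (k - d)) : ℕ) : ℝ) * (2 ^ (d - 1) * (d.factorial *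
      (2 ^ (d - 1) * d.factorial) ^ (k - d - 1) * ((k - d - 1).factorial * (n - k).factorial /
        (n - d).factorial))) ≤
      2 ^ (d - 1) * (2 * (d : ℝ) ^ (2 * d - 1) * (k.choose (d / 2) : ℝ)) ^ (k - d - 1)
        * ((k : ℝ) - d) * (n.descFactorial (k - 1) : ℝ)
        / ((n : ℝ) - k + 1) ^ (k - d - 1) := by
  have hchoose := choose_mul_choose_mul_factorial hk hn
  rw [← Nat.factorial_mul_descFactorial (show d ≤ n by omega)] at hchoose
  have hc : ((n.choose k * (k.choose d * (k - d)) : ℕ) : ℝ) * (d.factorial *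
      (k - d - 1).factorial * (n - k).factorial) =
      (n - d).factorial * n.descFactorial d := by exact_mod_cast hchoose
  have hM : (2 : ℝ) ^ (d - 1) * d.factorial ≤
      2 * (d : ℝ) ^ (2 * d - 1) * (k.choose (d / 2) : ℝ) := by
    exact_mod_cast two_pow_mul_factorial_le hd _ (Nat.choose_pos (by omega))
  have hD : (n.descFactorial d : ℝ) * ((n : ℝ) - k + 1) ^ (k - d - 1) ≤
      n.descFactorial (k - 1) := by
    have := descFactorial_mul_pow_le hk hn
    rw [← Nat.cast_sub hn]
    exact_mod_cast this
  have hpos : (0 : ℝ) < ((n : ℝ) - k + 1) ^ (k - d - 1) := by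
    rw [← Nat.cast_sub hn]; positivity
  have hkd : (1 : ℝ) ≤ (k : ℝ) - d := by
    have : (d : ℝ) + 1 ≤ k := by exact_mod_cast hk
    linarith
  have hfac : ((n - d).factorial : ℝ) ≠ 0 := by positivity
  rw [le_div_iff₀ hpos]
  set M : ℝ := 2 ^ (d - 1) * d.factorial
  set M' : ℝ := 2 * (d : ℝ) ^ (2 * d - 1) * (k.choose (d / 2) : ℝ)
  have hM0 : 0 ≤ M := by positivity
  calc _ = 2 ^ (d - 1) * M ^ (k - d - 1) * (((n.choose k * (k.choose d * (k - d)) : ℕ) : ℝ) *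
        (d.factorial * (k - d - 1).factorial * (n - k).factorial) / (n - d).factorial) *
        ((n : ℝ) - k + 1) ^ (k - d - 1) := by ring
    _ = 2 ^ (d - 1) * M ^ (k - d - 1) * 1 *
        (n.descFactorial d * ((n : ℝ) - k + 1) ^ (k - d - 1)) := by
      rw [hc, mul_div_cancel_left₀ _ hfac]; ring
    _ ≤ _ := by gcongr

lemma injective_of_forall_homDet_ne_zero {n d : ℕ} {P : Fin n → Fin d → ℝ} (hn : d + 1 ≤ n)
    (hd : 0 < d)
    (h : ∀ τ : Fin (d + 1) → Fin n, Function.Injective τ → homDet (fun i => P (τ i)) ≠ 0) :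
    Function.Injective P := by
  intro i j hij
  by_contra hne
  obtain ⟨A, hA, -, hAc⟩ := Finset.exists_subsuperset_card_eq
    (s := {i, j}) (t := Finset.univ) (n := d + 1) (Finset.subset_univ _)
    (by rw [Finset.card_pair hne]; omega) (by simpa using hn)
  have hr := Finset.range_orderEmbOfFin A hAc
  obtain ⟨a, ha⟩ : i ∈ Set.range (A.orderEmbOfFin hAc) := by rw [hr]; exact hA (by simp)
  obtain ⟨b, hb⟩ : j ∈ Set.range (A.orderEmbOfFin hAc) := by rw [hr]; exact hA (by simp)
  have := homDet_ne_zero_injective (h _ (A.orderEmbOfFin hAc).injective)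
    (show P (A.orderEmbOfFin hAc a) = P (A.orderEmbOfFin hAc b) by rw [ha, hb, hij])
  exact hne (by rw [← ha, ← hb, this])

lemma ncard_islands_le {n c k : ℕ} (hk : c + 2 ≤ k) (hn : k ≤ n) {K : Set (Fin (c + 1) → ℝ)}
    {S : Fin n → EuclideanSpace ℝ (Fin (c + 1))} (hSK : ∀ q, (S q).ofLp ∈ K)
    (hgen : ∀ τ : Fin (c + 2) → Fin n, Function.Injective τ →
      homDet (fun i => (S (τ i)).ofLp) ≠ 0) :
    (Set.ncard {I : Finset (EuclideanSpace ℝ (Fin (c + 1))) |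
        (I : Set (EuclideanSpace ℝ (Fin (c + 1)))) ⊆ Set.range S ∧ I.card = k ∧
        convexHull ℝ (I : Set (EuclideanSpace ℝ (Fin (c + 1)))) ∩ Set.range S
          = (I : Set (EuclideanSpace ℝ (Fin (c + 1))))} : ℝ) ≤
      ∑ I ∈ Finset.univ.powersetCard k, ∑ τ ∈ pointedFrames (c + 1) I,
        (frameEvent K I τ).indicator 1 (fun q => (S q).ofLp) := by
  classical
  have hS : Function.Injective S := fun i j hij =>
    injective_of_forall_homDet_ne_zero (P := fun q => (S q).ofLp) (hk.trans hn) c.succ_pos hgen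
      (congrArg WithLp.ofLp hij)
  set F : Finset (Finset (Fin n)) := (Finset.univ.powersetCard k).filter fun I =>
    ∃ τ ∈ pointedFrames (c + 1) I, (fun q => (S q).ofLp) ∈ frameEvent K I τ
  have h1 : Set.ncard {I : Finset (EuclideanSpace ℝ (Fin (c + 1))) |
        (I : Set (EuclideanSpace ℝ (Fin (c + 1)))) ⊆ Set.range S ∧ I.card = k ∧
        convexHull ℝ (I : Set (EuclideanSpace ℝ (Fin (c + 1)))) ∩ Set.range S
          = (I : Set (EuclideanSpace ℝ (Fin (c + 1))))} ≤ F.card := by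
    rw [← Set.ncard_coe_finset F]
    refine (Set.ncard_le_ncard (t := (fun I => I.image S) '' (F : Set (Finset (Fin n)))) ?_
      (F.finite_toSet.image _)).trans (Set.ncard_image_le F.finite_toSet)
    rintro I ⟨hI, hIk, hisl⟩
    have himage : (Finset.univ.filter fun q => S q ∈ I).image S = I := by
      ext x
      simp only [Finset.mem_image, Finset.mem_filter, Finset.mem_univ, true_and]
      refine ⟨?_, fun hx => ?_⟩
      · rintro ⟨q, hq, rfl⟩
        exact hq
      · obtain ⟨q, rfl⟩ := hI hx
        exact ⟨q, hx, rfl⟩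
    have hcard : (Finset.univ.filter fun q => S q ∈ I).card = k := by
      rw [← Finset.card_image_of_injective _ hS, himage, hIk]
    refine ⟨Finset.univ.filter fun q => S q ∈ I, ?_, himage⟩
    simp only [F, Finset.coe_filter, Set.mem_ofPred_eq, Finset.mem_powersetCard]
    refine ⟨⟨Finset.subset_univ _, hcard⟩, exists_mem_frameEvent hSK hgen (hcard ▸ hk) ?_⟩
    intro q hq
    rw [← Finset.coe_image, himage] at hq
    have : S q ∈ convexHull ℝ (I : Set (EuclideanSpace ℝ (Fin (c + 1)))) ∩ Set.range S :=
      ⟨hq, q, rfl⟩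
    rw [hisl] at this
    simpa using this
  have hnonneg : ∀ I τ, (0 : ℝ) ≤ (frameEvent K I τ).indicator 1 (fun q => (S q).ofLp) :=
    fun I τ => Set.indicator_nonneg (fun _ _ => zero_le_one) _
  calc _ ≤ (F.card : ℝ) := by exact_mod_cast h1
    _ = ∑ I ∈ F, (1 : ℝ) := by simp
    _ ≤ ∑ I ∈ F, ∑ τ ∈ pointedFrames (c + 1) I,
        (frameEvent K I τ).indicator 1 (fun q => (S q).ofLp) := by
      refine Finset.sum_le_sum fun I hI => ?_
      obtain ⟨τ, hτ, hmem⟩ := (Finset.mem_filter.1 hI).2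
      refine le_trans (le_of_eq ?_) (Finset.single_le_sum (fun τ _ => hnonneg I τ) hτ)
      rw [Set.indicator_of_mem hmem, Pi.one_apply]
    _ ≤ _ := Finset.sum_le_sum_of_subset_of_nonneg (Finset.filter_subset _ _) fun I _ _ =>
      Finset.sum_nonneg fun τ _ => hnonneg I τ

/-- Let `d ≥ 2`, `k ≥ d+1`, let `K ⊆ ℝ^d` be a convex body of volume `1`, and let `S` be
`n ≥ k` points chosen independently and uniformly at random from `K`. The expected number of
`k`-islands in `S` is at most
`2^{d-1} · (2 d^{2d-1} binom(k,⌊d/2⌋))^{k-d-1} · (k-d) · n(n-1)⋯(n-k+2) / (n-k+1)^{k-d-1}`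
(which is `O(n^d)` for fixed `d` and `k`). -/
theorem expected_k_islands_le
    (d k n : ℕ) (hd : 2 ≤ d) (hk : d + 1 ≤ k) (hn : k ≤ n)
    (K : Set (EuclideanSpace ℝ (Fin d)))
    (hKcomp : IsCompact K) (hKconv : Convex ℝ K) (hKint : (interior K).Nonempty)
    (hKvol : volume K = 1) :
    (∫ S : Fin n → EuclideanSpace ℝ (Fin d),
      (Set.ncard {I : Finset (EuclideanSpace ℝ (Fin d)) |
        (I : Set (EuclideanSpace ℝ (Fin d))) ⊆ Set.range S ∧ I.card = k ∧
        convexHull ℝ (I : Set (EuclideanSpace ℝ (Fin d))) ∩ Set.range S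
          = (I : Set (EuclideanSpace ℝ (Fin d)))} : ℝ)
      ∂(Measure.pi fun _ : Fin n => volume.restrict K))
    ≤ 2 ^ (d - 1) * (2 * (d : ℝ) ^ (2 * d - 1) * (k.choose (d / 2) : ℝ)) ^ (k - d - 1)
        * ((k : ℝ) - d) * (n.descFactorial (k - 1) : ℝ)
        / ((n : ℝ) - k + 1) ^ (k - d - 1) := by
  refine le_trans ?_ (sum_frame_bound_le hd hk hn)
  obtain ⟨c, rfl⟩ : ∃ c, d = c + 1 := ⟨d - 1, by omega⟩
  have hc : 0 < c := by omega
  obtain ⟨K', rfl⟩ : ∃ K' : Set (Fin (c + 1) → ℝ), K = WithLp.ofLp ⁻¹' K' :=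
    ⟨WithLp.toLp 2 ⁻¹' K, by ext; simp⟩
  have himage : K' = WithLp.toLp 2 ⁻¹'
      (WithLp.ofLp ⁻¹' K' : Set (EuclideanSpace ℝ (Fin (c + 1)))) := by ext; simp
  have hK'm : MeasurableSet K' := by
    rw [himage]
    exact (hKcomp.isClosed.preimage (PiLp.continuous_toLp 2 _)).measurableSet
  have hK'conv : Convex ℝ K' := by
    rw [himage]
    exact hKconv.linear_preimage (WithLp.linearEquiv 2 ℝ (Fin (c + 1) → ℝ)).symm.toLinearMap
  have hK'vol : volume K' = 1 := by
    rw [← hKvol, (PiLp.volume_preserving_ofLp _).measure_preimage hK'm.nullMeasurableSet]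
  have hmp := measurePreserving_pi_restrict_ofLp n (c + 1) K' hK'm
  set μ : Measure (Fin n → EuclideanSpace ℝ (Fin (c + 1))) :=
    Measure.pi fun _ => volume.restrict (WithLp.ofLp ⁻¹' K')
  have : IsProbabilityMeasure (volume.restrict
      (WithLp.ofLp ⁻¹' K' : Set (EuclideanSpace ℝ (Fin (c + 1))))) :=
    ⟨by rw [Measure.restrict_apply_univ, hKvol]⟩
  have hmem : ∀ᵐ S ∂μ, ∀ q, (S q).ofLp ∈ K' := by
    refine ae_all_iff.2 fun q => ?_
    exact (measurePreserving_eval (fun _ : Fin n => volume.restrict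
      (WithLp.ofLp ⁻¹' K' : Set (EuclideanSpace ℝ (Fin (c + 1))))) q).quasiMeasurePreserving.ae
      (ae_restrict_mem hKcomp.measurableSet)
  have hgen : ∀ᵐ S ∂μ, ∀ τ : Fin (c + 2) → Fin n, Function.Injective τ →
      homDet (fun i => (S (τ i)).ofLp) ≠ 0 := by
    refine ae_all_iff.2 fun τ => ?_
    by_cases hτ : Function.Injective τ
    · filter_upwards [hmp.quasiMeasurePreserving.ae (ae_homDet_ne_zero K' τ hτ)] with S hS _
      exact hS
    · exact ae_of_all _ fun S h => (hτ h).elim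
  have hE : ∀ I τ, MeasurableSet ((fun (S : Fin n → EuclideanSpace ℝ (Fin (c + 1))) q =>
      (S q).ofLp) ⁻¹' frameEvent K' I τ) := fun I τ =>
    hmp.measurable (measurableSet_frameEvent hK'm I τ)
  have hint : ∀ I τ, Integrable (fun S : Fin n → EuclideanSpace ℝ (Fin (c + 1)) =>
      (frameEvent K' I τ).indicator (1 : (Fin n → Fin (c + 1) → ℝ) → ℝ)
        fun q => (S q).ofLp) μ := fun I τ =>
    (integrable_const (1 : ℝ)).indicator (hE I τ)
  have hsum : Integrable (fun S => ∑ I ∈ Finset.univ.powersetCard k,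
      ∑ τ ∈ pointedFrames (c + 1) I, (frameEvent K' I τ).indicator
        (1 : (Fin n → Fin (c + 1) → ℝ) → ℝ) fun q => (S q).ofLp) μ :=
    integrable_finsetSum _ fun I _ => integrable_finsetSum _ fun τ _ => hint I τ
  refine (integral_mono_of_nonneg (ae_of_all _ fun S => Nat.cast_nonneg _) hsum
    ((hmem.and hgen).mono fun S hS => ncard_islands_le hk hn hS.1 hS.2)).trans ?_
  rw [integral_finsetSum _ fun I _ => integrable_finsetSum _ fun τ _ => hint I τ]
  set β : ℝ := 2 ^ (c + 1 - 1) * ((c + 1).factorial *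
      (2 ^ (c + 1 - 1) * (c + 1).factorial) ^ (k - (c + 1) - 1) *
        ((k - (c + 1) - 1).factorial * (n - k).factorial / (n - (c + 1)).factorial))
  have hβ0 : 0 ≤ β := by positivity
  calc _ ≤ ∑ I ∈ Finset.univ.powersetCard k, (k.choose (c + 1) * (k - (c + 1)) : ℕ) * β := by
        refine Finset.sum_le_sum fun I hI => ?_
        rw [Finset.mem_powersetCard] at hI
        rw [integral_finsetSum _ fun τ _ => hint I τ]
        have hτ : ∀ τ ∈ pointedFrames (c + 1) I, ∫ S, (frameEvent K' I τ).indicator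
            (1 : (Fin n → Fin (c + 1) → ℝ) → ℝ) (fun q => (S q).ofLp) ∂μ ≤ β := by
          intro τ hτ
          simp only [pointedFrames, Finset.mem_filter] at hτ
          have h := measure_frameEvent_le hc hK'm hK'conv hK'vol hτ.2.2.1 hτ.2.2.2
          rw [← hmp.measure_preimage (measurableSet_frameEvent hK'm I τ).nullMeasurableSet,
            hI.2, show n - (c + 2) + 1 = n - (c + 1) by omega,
            show k - (c + 2) = k - (c + 1) - 1 by omega] at h
          refine le_of_eq_of_le (integral_indicator_one (hE I τ)) ?_
          exact ENNReal.toReal_le_of_le_ofReal hβ0 h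
        refine (Finset.sum_le_card_nsmul _ _ β hτ).trans ?_
        rw [nsmul_eq_mul]
        refine mul_le_mul_of_nonneg_right ?_ hβ0
        exact_mod_cast hI.2 ▸ card_pointedFrames_le I
    _ = _ := by
      rw [Finset.sum_const, Finset.card_powersetCard, Finset.card_univ, Fintype.card_fin,
        nsmul_eq_mul]
      rw [Nat.cast_mul (n.choose k), mul_assoc]
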